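/- Let n ≥ 3 and a > 0, and set C_n(a) := (n-2)^{-2(n-1)/n} S_n if a ≥ 1/(n-2) and C_n(a) := a^{2(n-1)/n} S_n if 0 < a < 1/(n-2). Then C_n(a) is the best constant in the weighted inequality on B_1: for every C > C_n(a) there exists a nonzero v ∈ C_c^∞(B_1) such that ∫_{B_1} |x|^{-(n-2)} |∇v|² dx < C · ( ∫_{B_1} |x|^{-n} X_1(a,|x|)^{2(n-1)/(n-2)} |v|^{2n/(n-2)} dx )^{(n-2)/n}. -/

import Mathlib

open MeasureTheory Real

/-- The best Sobolev constant `S_n = π n (n-2) (Γ(n/2)/Γ(n))^(2/n)`. -/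
noncomputable def sobolevConst (n : ℕ) : ℝ :=
  Real.pi * n * ((n : ℝ) - 2) * (Real.Gamma ((n : ℝ) / 2) / Real.Gamma (n : ℝ)) ^ (2 / (n : ℝ))

/-- `X_1(a,s) = (a - ln s)⁻¹`. -/
noncomputable def X1 (a s : ℝ) : ℝ := (a - Real.log s)⁻¹

theorem integrableOn_and_integral_beta {u v : ℝ} (hu : 0 < u) (hv : 0 < v) :
    IntegrableOn (fun t : ℝ => t ^ (u - 1) * (1 - t) ^ (v - 1)) (Set.Ioo 0 1) ∧
      ∫ t in Set.Ioo (0 : ℝ) 1, t ^ (u - 1) * (1 - t) ^ (v - 1) =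
        ProbabilityTheory.beta u v := by
  have hb := ProbabilityTheory.beta_pos hu hv
  have h1 := ProbabilityTheory.lintegral_betaPDF_eq_one hu hv
  unfold ProbabilityTheory.betaPDF at h1
  have hnn : ∀ x, 0 ≤ ProbabilityTheory.betaPDFReal u v x := by
    intro x
    by_cases hx : 0 < x ∧ x < 1
    · exact (ProbabilityTheory.betaPDFReal_pos hx.1 hx.2 hu hv).le
    · simp [ProbabilityTheory.betaPDFReal, hx]
  have hm := ProbabilityTheory.stronglyMeasurable_betaPDFReal u v
  have hint : Integrable (ProbabilityTheory.betaPDFReal u v) := by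
    rw [← lintegral_ofReal_ne_top_iff_integrable hm.aestronglyMeasurable
      (Filter.Eventually.of_forall hnn), h1]
    simp
  have hval : ∫ x, ProbabilityTheory.betaPDFReal u v x = 1 := by
    rw [integral_eq_lintegral_of_nonneg_ae (Filter.Eventually.of_forall hnn)
      hm.aestronglyMeasurable, h1]
    simp
  have heq : (Set.Ioo (0 : ℝ) 1).indicator (fun t : ℝ => t ^ (u - 1) * (1 - t) ^ (v - 1)) =
      fun x => ProbabilityTheory.beta u v * ProbabilityTheory.betaPDFReal u v x := by
    funext x
    by_cases hx : 0 < x ∧ x < 1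
    · simp [ProbabilityTheory.betaPDFReal, Set.indicator, hx]
      field_simp
    · simp [ProbabilityTheory.betaPDFReal, Set.indicator, hx]
  constructor
  · rw [← integrable_indicator_iff measurableSet_Ioo, heq]
    exact hint.const_mul _
  · rw [← integral_indicator measurableSet_Ioo, heq, integral_const_mul, hval, mul_one]

theorem image_sq_div_one_add_sq :
    (fun s : ℝ => s ^ 2 / (1 + s ^ 2)) '' Set.Ioi 0 = Set.Ioo 0 1 := by
  ext t
  constructor
  · rintro ⟨s, hs, rfl⟩
    have hs : 0 < s := hs
    refine ⟨by positivity, ?_⟩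
    change s ^ 2 / (1 + s ^ 2) < 1
    rw [div_lt_one (by positivity)]
    linarith
  · rintro ⟨h0, h1⟩
    have h : 0 < t / (1 - t) := div_pos h0 (by linarith)
    refine ⟨√(t / (1 - t)), Real.sqrt_pos.2 h, ?_⟩
    have : 1 - t ≠ 0 := by linarith
    simp only [Real.sq_sqrt h.le]
    field_simp
    ring

theorem integrableOn_and_integral_rpow_mul_one_add_sq_rpow {u v : ℝ} (hu : 0 < u) (hv : 0 < v) :
    IntegrableOn (fun s : ℝ => s ^ (2 * u - 1) * (1 + s ^ 2) ^ (-(u + v))) (Set.Ioi 0) ∧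
      ∫ s in Set.Ioi (0 : ℝ), s ^ (2 * u - 1) * (1 + s ^ 2) ^ (-(u + v)) =
        ProbabilityTheory.beta u v / 2 := by
  have hd : ∀ s ∈ Set.Ioi (0 : ℝ), HasDerivWithinAt (fun s : ℝ => s ^ 2 / (1 + s ^ 2))
      (2 * s / (1 + s ^ 2) ^ 2) (Set.Ioi 0) s := by
    intro s hs
    have h := ((hasDerivAt_pow 2 s).div ((hasDerivAt_pow 2 s).const_add 1)
      (by positivity)).hasDerivWithinAt (s := Set.Ioi 0)
    refine h.congr_deriv ?_
    simp
    ring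
  have hinj : Set.InjOn (fun s : ℝ => s ^ 2 / (1 + s ^ 2)) (Set.Ioi 0) := by
    intro x hx y hy h
    have hx : 0 < x := hx
    have hy : 0 < y := hy
    simp only at h
    rw [div_eq_div_iff (by positivity) (by positivity)] at h
    have : x ^ 2 = y ^ 2 := by linarith
    exact (pow_left_inj₀ hx.le hy.le two_ne_zero).1 this
  have key : Set.EqOn (fun s : ℝ => |2 * s / (1 + s ^ 2) ^ 2| •
      ((s ^ 2 / (1 + s ^ 2)) ^ (u - 1) * (1 - s ^ 2 / (1 + s ^ 2)) ^ (v - 1)))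
      (fun s : ℝ => 2 * (s ^ (2 * u - 1) * (1 + s ^ 2) ^ (-(u + v)))) (Set.Ioi 0) := by
    intro s hs
    have hs : 0 < s := hs
    have hp : 0 < 1 + s ^ 2 := by positivity
    have e1 : 1 - s ^ 2 / (1 + s ^ 2) = (1 + s ^ 2)⁻¹ := by field_simp; ring
    have e2 : (s ^ 2) ^ (u - 1) * s = s ^ (2 * u - 1) := by
      rw [← Real.rpow_natCast, ← Real.rpow_mul hs.le, ← Real.rpow_add_one hs.ne']
      congr 1; push_cast; ring
    have e3 : (1 + s ^ 2) ^ (-(u + v)) =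
        ((1 + s ^ 2) ^ (u - 1))⁻¹ * ((1 + s ^ 2) ^ (v - 1))⁻¹ * ((1 + s ^ 2) ^ 2)⁻¹ := by
      rw [← Real.rpow_natCast (1 + s ^ 2) 2, ← Real.rpow_neg hp.le, ← Real.rpow_neg hp.le,
        ← Real.rpow_neg hp.le, ← Real.rpow_add hp, ← Real.rpow_add hp]
      congr 1; push_cast; ring
    simp only [smul_eq_mul]
    rw [abs_of_pos (by positivity), e1, Real.div_rpow (by positivity) hp.le,
      Real.inv_rpow hp.le, e3, ← e2]
    ring
  obtain ⟨hi, hv'⟩ := integrableOn_and_integral_beta hu hv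
  rw [← image_sq_div_one_add_sq] at hi hv'
  rw [integral_image_eq_integral_abs_deriv_smul measurableSet_Ioi hd hinj,
    setIntegral_congr_fun measurableSet_Ioi key, integral_const_mul] at hv'
  rw [integrableOn_image_iff_integrableOn_abs_deriv_smul measurableSet_Ioi hd hinj,
    integrableOn_congr_fun key measurableSet_Ioi] at hi
  refine ⟨?_, by linarith⟩
  have := hi.const_mul (1 / 2)
  refine this.congr (Filter.Eventually.of_forall fun s => ?_)
  simp

theorem exists_smooth_truncation {ε : ℝ} (hε : 0 < ε) :
    ∃ H : ℝ → ℝ, ContDiff ℝ (⊤ : ℕ∞) H ∧ (∀ u, |deriv H u| ≤ 1) ∧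
      (∃ δ > 0, (∀ u ≤ δ, H u = 0) ∧ ∀ u ≥ 1 - δ, H u = H 1) ∧
      ∀ u, 0 ≤ u → u ≤ 1 → 0 ≤ H u ∧ H u ≤ u ∧ u - ε ≤ H u := by
  obtain ⟨δ, hδ, hδε, hδ1⟩ : ∃ δ : ℝ, 0 < δ ∧ 4 * δ ≤ ε ∧ δ ≤ 1 / 8 :=
    ⟨min (ε / 4) (1 / 8), by positivity, by linarith [min_le_left (ε / 4) (1 / 8 : ℝ)],
      min_le_right _ _⟩
  let χ : ContDiffBump (1 / 2 : ℝ) :=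
    ⟨1 / 2 - 2 * δ, 1 / 2 - δ, by linarith, by linarith⟩
  have hcont : Continuous (χ : ℝ → ℝ) := χ.continuous
  have hii : ∀ x y : ℝ, IntervalIntegrable (χ : ℝ → ℝ) volume x y :=
    fun x y => hcont.intervalIntegrable x y
  have hder : ∀ u, HasDerivAt (fun u => ∫ t in (0 : ℝ)..u, χ t) (χ u) u := fun u =>
    intervalIntegral.integral_hasDerivAt_right (hii _ _)
      (hcont.stronglyMeasurableAtFilter _ _) hcont.continuousAt
  have hderiv : deriv (fun u => ∫ t in (0 : ℝ)..u, χ t) = χ := funext fun u => (hder u).deriv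
  have hsub : ∀ x y : ℝ, (∫ t in (0 : ℝ)..y, χ t) - (∫ t in (0 : ℝ)..x, χ t) =
      ∫ t in x..y, χ t := fun x y =>
    intervalIntegral.integral_interval_sub_left (hii _ _) (hii _ _)
  have hleft : ∀ t ≤ δ, χ t = 0 := fun t ht => χ.zero_of_le_dist (by
    rw [Real.dist_eq, abs_sub_comm]
    exact le_trans (show (1 / 2 - δ : ℝ) ≤ 1 / 2 - t by linarith) (le_abs_self _))
  have hright : ∀ t ≥ 1 - δ, χ t = 0 := fun t ht => χ.zero_of_le_dist (by
    rw [Real.dist_eq]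
    exact le_trans (show (1 / 2 - δ : ℝ) ≤ t - 1 / 2 by linarith) (le_abs_self _))
  have hmid : ∀ t, 2 * δ ≤ t → t ≤ 1 - 2 * δ → χ t = 1 := fun t h1 h2 =>
    χ.one_of_mem_closedBall (by
      rw [Metric.mem_closedBall, Real.dist_eq, abs_le]
      constructor
      · change -(1 / 2 - 2 * δ) ≤ _; linarith
      · change _ ≤ 1 / 2 - 2 * δ; linarith)
  refine ⟨fun u => ∫ t in (0 : ℝ)..u, χ t, ?_, ?_, ⟨δ, hδ, ?_, ?_⟩, ?_⟩
  · rw [contDiff_infty_iff_deriv, hderiv]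
    exact ⟨fun u => (hder u).differentiableAt, χ.contDiff⟩
  · intro u
    rw [hderiv, abs_of_nonneg χ.nonneg]
    exact χ.le_one
  · intro u hu
    simp only
    rw [intervalIntegral.integral_congr (g := fun _ => (0 : ℝ)), intervalIntegral.integral_zero]
    intro t ht
    apply hleft
    rcases Set.mem_uIcc.1 ht with h | h <;> linarith [h.1, h.2]
  · intro u hu
    have h1 : ∫ t in u..1, χ t = 0 := by
      rw [intervalIntegral.integral_congr (g := fun _ => (0 : ℝ)), intervalIntegral.integral_zero]
      intro t ht
      apply hright
      rcases Set.mem_uIcc.1 ht with h | h <;> linarith [h.1, h.2]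
    have := hsub u 1
    simp only
    linarith
  · intro u hu0 hu1
    simp only
    have hle : ∀ x y : ℝ, x ≤ y → ∫ t in x..y, χ t ≤ y - x := by
      intro x y hxy
      have := intervalIntegral.integral_mono_on hxy (hii x y)
        (intervalIntegrable_const (c := (1 : ℝ))) (fun t _ => χ.le_one)
      simpa using this
    have hge : ∀ x y : ℝ, x ≤ y → 0 ≤ ∫ t in x..y, χ t := fun x y hxy =>
      intervalIntegral.integral_nonneg hxy fun t _ => χ.nonneg
    have hm : ∫ t in (2 * δ)..(1 - 2 * δ), χ t = 1 - 4 * δ := by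
      rw [intervalIntegral.integral_congr (g := fun _ => (1 : ℝ))]
      · simp; ring
      · intro t ht
        rw [Set.uIcc_of_le (by linarith)] at ht
        exact hmid t ht.1 ht.2
    refine ⟨hge 0 u hu0, by simpa using hle 0 u hu0, ?_⟩
    have h1 := hsub u 1
    have h2 := hsub (2 * δ) (1 - 2 * δ)
    have h3 := hsub (1 - 2 * δ) 1
    have h4 := hle u 1 hu1
    have h5 := hge 0 (2 * δ) (by linarith)
    have h6 := hge (1 - 2 * δ) 1 (by linarith)
    linarith

/-- The surface measure `n |B_1|` of the unit sphere in `ℝⁿ`. -/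
noncomputable def sphereArea (n : ℕ) : ℝ :=
  n * volume.real (Metric.ball (0 : EuclideanSpace ℝ (Fin n)) 1)

theorem sphereArea_eq {n : ℕ} (hn : 3 ≤ n) :
    sphereArea n = 2 * π ^ ((n : ℝ) / 2) / Real.Gamma ((n : ℝ) / 2) := by
  have : Nonempty (Fin n) := ⟨⟨0, by lia⟩⟩
  have hn0 : (0 : ℝ) < n / 2 := by
    have : (3 : ℝ) ≤ n := by exact_mod_cast hn
    linarith
  have hG := Real.Gamma_pos_of_pos hn0
  rw [sphereArea, Measure.real, EuclideanSpace.volume_ball, Fintype.card_fin,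
    Real.Gamma_add_one hn0.ne', ENNReal.ofReal_one, one_pow, one_mul,
    ENNReal.toReal_ofReal (by positivity), Real.sqrt_eq_rpow, ← Real.rpow_natCast,
    ← Real.rpow_mul pi_pos.le]
  rw [show (1 / 2 : ℝ) * n = n / 2 by ring]
  field_simp

theorem integral_norm_eq_sphereArea_mul {n : ℕ} (hn : 3 ≤ n) (f : ℝ → ℝ) :
    ∫ x : EuclideanSpace ℝ (Fin n), f ‖x‖ =
      sphereArea n * ∫ r in Set.Ioi (0 : ℝ), r ^ (n - 1) * f r := by
  have : Nonempty (Fin n) := ⟨⟨0, by lia⟩⟩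
  rw [integral_fun_norm_addHaar, finrank_euclideanSpace_fin, sphereArea]
  simp [mul_assoc]

/-- The radial profile of the extremal functions in the Sobolev inequality. -/
noncomputable def talenti (n : ℕ) (s : ℝ) : ℝ := (1 + s ^ 2) ^ (-(((n : ℝ) - 2) / 2))

theorem talenti_pos (n : ℕ) (s : ℝ) : 0 < talenti n s := by
  unfold talenti; positivity

theorem talenti_le_one {n : ℕ} (hn : 3 ≤ n) (s : ℝ) : talenti n s ≤ 1 := by
  have : (3 : ℝ) ≤ n := by exact_mod_cast hn
  exact Real.rpow_le_one_of_one_le_of_nonpos (by nlinarith [sq_nonneg s]) (by linarith)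

theorem contDiff_talenti (n : ℕ) : ContDiff ℝ (⊤ : ℕ∞) (talenti n) := by
  unfold talenti
  refine ContDiff.rpow_const_of_ne (by fun_prop) fun s => by positivity

theorem hasDerivAt_talenti (n : ℕ) (s : ℝ) :
    HasDerivAt (talenti n) (-((n : ℝ) - 2) * s * (1 + s ^ 2) ^ (-((n : ℝ) / 2))) s := by
  have h := ((hasDerivAt_pow 2 s).const_add 1).rpow_const (p := -(((n : ℝ) - 2) / 2))
    (Or.inl (by positivity))
  refine h.congr_deriv ?_
  rw [show -(((n : ℝ) - 2) / 2) - 1 = -((n : ℝ) / 2) by ring]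
  push_cast
  ring

theorem tendsto_talenti_atTop {n : ℕ} (hn : 3 ≤ n) :
    Filter.Tendsto (talenti n) Filter.atTop (nhds 0) := by
  have : (3 : ℝ) ≤ n := by exact_mod_cast hn
  refine (tendsto_rpow_neg_atTop (y := ((n : ℝ) - 2) / 2) (by linarith)).comp ?_
  exact Filter.tendsto_atTop_add_const_left _ _ (Filter.tendsto_pow_atTop two_ne_zero)

theorem integrableOn_and_integral_talenti_deriv_sq {n : ℕ} (hn : 3 ≤ n) :
    IntegrableOn (fun s : ℝ => s ^ (n - 1) * (deriv (talenti n) s) ^ 2) (Set.Ioi 0) ∧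
      ∫ s in Set.Ioi (0 : ℝ), s ^ (n - 1) * (deriv (talenti n) s) ^ 2 =
        n * ((n : ℝ) - 2) * (ProbabilityTheory.beta ((n : ℝ) / 2) ((n : ℝ) / 2) / 2) := by
  have hn' : (3 : ℝ) ≤ n := by exact_mod_cast hn
  obtain ⟨hi, hv⟩ := integrableOn_and_integral_rpow_mul_one_add_sq_rpow
    (u := (n : ℝ) / 2 + 1) (v := (n : ℝ) / 2 - 1) (by linarith) (by linarith)
  have key : Set.EqOn (fun s : ℝ => s ^ (n - 1) * (deriv (talenti n) s) ^ 2)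
      (fun s : ℝ => ((n : ℝ) - 2) ^ 2 * (s ^ (2 * ((n : ℝ) / 2 + 1) - 1) *
        (1 + s ^ 2) ^ (-((n : ℝ) / 2 + 1 + ((n : ℝ) / 2 - 1))))) (Set.Ioi 0) := by
    intro s hs
    have hs : 0 < s := hs
    have hp : 0 < 1 + s ^ 2 := by positivity
    have e1 : s ^ (2 * ((n : ℝ) / 2 + 1) - 1) = s ^ (n - 1) * s ^ 2 := by
      rw [← pow_add, ← Real.rpow_natCast, show n - 1 + 2 = n + 1 by lia]
      congr 1; push_cast; ring
    have e2 : (1 + s ^ 2) ^ (-((n : ℝ) / 2 + 1 + ((n : ℝ) / 2 - 1))) =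
        ((1 + s ^ 2) ^ (-((n : ℝ) / 2))) ^ 2 := by
      rw [← Real.rpow_natCast ((1 + s ^ 2) ^ (-((n : ℝ) / 2))), ← Real.rpow_mul hp.le]
      congr 1; push_cast; ring
    simp only [(hasDerivAt_talenti n s).deriv, e1, e2]
    ring
  constructor
  · rw [integrableOn_congr_fun key measurableSet_Ioi]
    exact hi.const_mul _
  · rw [setIntegral_congr_fun measurableSet_Ioi key, integral_const_mul, hv]
    unfold ProbabilityTheory.beta
    have h1 : Real.Gamma ((n : ℝ) / 2 + 1) = (n : ℝ) / 2 * Real.Gamma ((n : ℝ) / 2) :=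
      Real.Gamma_add_one (by linarith)
    have h2 : Real.Gamma ((n : ℝ) / 2) = ((n : ℝ) / 2 - 1) * Real.Gamma ((n : ℝ) / 2 - 1) := by
      rw [← Real.Gamma_add_one (by linarith)]
      congr 1; ring
    rw [h1, show (n : ℝ) / 2 + 1 + ((n : ℝ) / 2 - 1) = (n : ℝ) / 2 + (n : ℝ) / 2 by ring]
    have h3 : Real.Gamma ((n : ℝ) / 2) * Real.Gamma ((n : ℝ) / 2) =
      Real.Gamma ((n : ℝ) / 2) * (((n : ℝ) / 2 - 1) * Real.Gamma ((n : ℝ) / 2 - 1)) := by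
        rw [← h2]
    rw [h3]
    ring

theorem integrableOn_and_integral_talenti_rpow {n : ℕ} (hn : 3 ≤ n) :
    IntegrableOn (fun s : ℝ => s ^ (n - 1) * talenti n s ^ (2 * (n : ℝ) / ((n : ℝ) - 2)))
      (Set.Ioi 0) ∧
      ∫ s in Set.Ioi (0 : ℝ), s ^ (n - 1) * talenti n s ^ (2 * (n : ℝ) / ((n : ℝ) - 2)) =
        ProbabilityTheory.beta ((n : ℝ) / 2) ((n : ℝ) / 2) / 2 := by
  have hn' : (3 : ℝ) ≤ n := by exact_mod_cast hn
  obtain ⟨hi, hv⟩ := integrableOn_and_integral_rpow_mul_one_add_sq_rpow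
    (u := (n : ℝ) / 2) (v := (n : ℝ) / 2) (by linarith) (by linarith)
  have key : Set.EqOn
      (fun s : ℝ => s ^ (n - 1) * talenti n s ^ (2 * (n : ℝ) / ((n : ℝ) - 2)))
      (fun s : ℝ => s ^ (2 * ((n : ℝ) / 2) - 1) *
        (1 + s ^ 2) ^ (-((n : ℝ) / 2 + (n : ℝ) / 2))) (Set.Ioi 0) := by
    intro s hs
    have hs : 0 < s := hs
    have hp : 0 < 1 + s ^ 2 := by positivity
    have h2 : (n : ℝ) - 2 ≠ 0 := by linarith
    simp only [talenti]
    rw [← Real.rpow_mul hp.le, ← Real.rpow_natCast, Nat.cast_sub (by lia)]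
    congr 2
    · push_cast; ring
    · field_simp; ring
  constructor
  · rw [integrableOn_congr_fun key measurableSet_Ioi]
    exact hi
  · rw [setIntegral_congr_fun measurableSet_Ioi key, hv]

/-- The profile `talenti n` attains equality in the Sobolev inequality. -/
theorem sobolevConst_mul_beta_rpow {n : ℕ} (hn : 3 ≤ n) :
    sobolevConst n * (sphereArea n *
      (ProbabilityTheory.beta ((n : ℝ) / 2) ((n : ℝ) / 2) / 2)) ^ (((n : ℝ) - 2) / n) =
    sphereArea n *
      (n * ((n : ℝ) - 2) * (ProbabilityTheory.beta ((n : ℝ) / 2) ((n : ℝ) / 2) / 2)) := by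
  have hn' : (3 : ℝ) ≤ n := by exact_mod_cast hn
  have hG := Real.Gamma_pos_of_pos (show (0 : ℝ) < n / 2 by linarith)
  have hG' := Real.Gamma_pos_of_pos (show (0 : ℝ) < n by linarith)
  have hB : sphereArea n * (ProbabilityTheory.beta ((n : ℝ) / 2) ((n : ℝ) / 2) / 2) =
      π ^ ((n : ℝ) / 2) * (Real.Gamma ((n : ℝ) / 2) / Real.Gamma n) := by
    rw [sphereArea_eq hn, ProbabilityTheory.beta, add_halves]
    field_simp
  have hq : 0 < Real.Gamma ((n : ℝ) / 2) / Real.Gamma n := by positivity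
  have hBpos : 0 < π ^ ((n : ℝ) / 2) * (Real.Gamma ((n : ℝ) / 2) / Real.Gamma n) := by positivity
  have hS : sobolevConst n =
      n * ((n : ℝ) - 2) * (π ^ ((n : ℝ) / 2) * (Real.Gamma ((n : ℝ) / 2) / Real.Gamma n)) ^
        (2 / (n : ℝ)) := by
    rw [sobolevConst, Real.mul_rpow (by positivity) hq.le, ← Real.rpow_mul pi_pos.le,
      show (n : ℝ) / 2 * (2 / n) = 1 by field_simp, Real.rpow_one]
    ring
  rw [show sphereArea n *
      (n * ((n : ℝ) - 2) * (ProbabilityTheory.beta ((n : ℝ) / 2) ((n : ℝ) / 2) / 2)) =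
      n * ((n : ℝ) - 2) *
        (sphereArea n * (ProbabilityTheory.beta ((n : ℝ) / 2) ((n : ℝ) / 2) / 2)) by ring,
    hB, hS, mul_assoc, ← Real.rpow_add hBpos, show 2 / (n : ℝ) + ((n : ℝ) - 2) / n = 1 by
      field_simp; ring, Real.rpow_one]

theorem exists_nearly_extremal_profile {n : ℕ} (hn : 3 ≤ n) {C : ℝ} (hC : sobolevConst n < C) :
    ∃ φ : ℝ → ℝ, ContDiff ℝ (⊤ : ℕ∞) φ ∧ (∃ s₀ > 0, ∀ s, |s| < s₀ → φ s = φ 0) ∧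
      (∃ s₁ > 0, ∀ s ≥ s₁, φ s = 0) ∧
      sphereArea n * ∫ s in Set.Ioi (0 : ℝ), s ^ (n - 1) * (deriv φ s) ^ 2 <
        C * (sphereArea n * ∫ s in Set.Ioi (0 : ℝ),
          s ^ (n - 1) * |φ s| ^ (2 * (n : ℝ) / ((n : ℝ) - 2))) ^ (((n : ℝ) - 2) / n) := by
  have hn' : (3 : ℝ) ≤ n := by exact_mod_cast hn
  obtain ⟨hFi, hF⟩ := integrableOn_and_integral_talenti_deriv_sq hn
  obtain ⟨hGi, hG⟩ := integrableOn_and_integral_talenti_rpow hn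
  have hp : 0 < 2 * (n : ℝ) / ((n : ℝ) - 2) := div_pos (by linarith) (by linarith)
  have hθ : 0 < ((n : ℝ) - 2) / n := div_pos (by linarith) (by linarith)
  have hσ : 0 < sphereArea n := by
    rw [sphereArea_eq hn]
    have := Real.Gamma_pos_of_pos (show (0 : ℝ) < n / 2 by linarith)
    positivity
  have hβ := ProbabilityTheory.beta_pos (show (0 : ℝ) < n / 2 by linarith)
    (show (0 : ℝ) < n / 2 by linarith)
  choose H hHs hHd hHc hHb using fun k : ℕ =>
    exists_smooth_truncation (ε := 1 / ((k : ℝ) + 1)) (by positivity)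
  have htal : ∀ k s, 0 ≤ H k (talenti n s) ∧ H k (talenti n s) ≤ talenti n s ∧
      talenti n s - 1 / ((k : ℝ) + 1) ≤ H k (talenti n s) := fun k s =>
    hHb k _ (talenti_pos n s).le (talenti_le_one hn s)
  have hlim : ∀ s, Filter.Tendsto (fun k => H k (talenti n s)) Filter.atTop
      (nhds (talenti n s)) := by
    intro s
    refine tendsto_of_tendsto_of_tendsto_of_le_of_le ?_ tendsto_const_nhds
      (fun k => (htal k s).2.2) (fun k => (htal k s).2.1)
    simpa using tendsto_const_nhds.sub (tendsto_one_div_add_atTop_nhds_zero_nat (𝕜 := ℝ))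
  have hGlim : Filter.Tendsto (fun k => ∫ s in Set.Ioi (0 : ℝ),
      s ^ (n - 1) * |H k (talenti n s)| ^ (2 * (n : ℝ) / ((n : ℝ) - 2))) Filter.atTop
      (nhds (∫ s in Set.Ioi (0 : ℝ),
        s ^ (n - 1) * talenti n s ^ (2 * (n : ℝ) / ((n : ℝ) - 2)))) := by
    refine tendsto_integral_of_dominated_convergence _ (fun k => ?_) hGi (fun k => ?_) ?_
    · refine Continuous.aestronglyMeasurable ?_
      refine (continuous_pow _).mul (Continuous.rpow_const ?_ fun _ => Or.inr hp.le)
      exact ((hHs k).continuous.comp (contDiff_talenti n).continuous).abs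
    · refine (ae_restrict_iff' measurableSet_Ioi).2 (Filter.Eventually.of_forall fun s hs => ?_)
      have hs : 0 < s := hs
      rw [Real.norm_of_nonneg (by positivity), abs_of_nonneg (htal k s).1]
      have := Real.rpow_le_rpow (htal k s).1 (htal k s).2.1 hp.le
      gcongr
    · refine Filter.Eventually.of_forall fun s => Filter.Tendsto.const_mul _ ?_
      have h := ((hlim s).abs).rpow_const (p := 2 * (n : ℝ) / ((n : ℝ) - 2)) (Or.inr hp.le)
      rwa [abs_of_pos (talenti_pos n s)] at h
  have hRlim := (((hGlim.const_mul (sphereArea n)).rpow_const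
    (p := ((n : ℝ) - 2) / n) (Or.inr hθ.le)).const_mul C)
  have hstrict : sphereArea n *
      ∫ s in Set.Ioi (0 : ℝ), s ^ (n - 1) * (deriv (talenti n) s) ^ 2 <
      C * (sphereArea n * ∫ s in Set.Ioi (0 : ℝ),
        s ^ (n - 1) * talenti n s ^ (2 * (n : ℝ) / ((n : ℝ) - 2))) ^ (((n : ℝ) - 2) / n) := by
    rw [hF, hG, ← sobolevConst_mul_beta_rpow hn]
    gcongr
  obtain ⟨k, hk⟩ := (hRlim.eventually (lt_mem_nhds hstrict)).exists
  obtain ⟨δ, hδ, h0, h1⟩ := hHc k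
  refine ⟨fun s => H k (talenti n s), (hHs k).comp (contDiff_talenti n), ?_, ?_, ?_⟩
  · have hcont : ContinuousAt (talenti n) 0 := (contDiff_talenti n).continuous.continuousAt
    have h01 : talenti n 0 = 1 := by simp [talenti]
    have hev : ∀ᶠ s in nhds (0 : ℝ), 1 - δ < talenti n s :=
      hcont.eventually (lt_mem_nhds (by rw [h01]; linarith))
    obtain ⟨s₀, hs₀, hball⟩ := Metric.eventually_nhds_iff.1 hev
    refine ⟨s₀, hs₀, fun s hs => ?_⟩
    simp only
    rw [h1 _ (hball (by simpa [Real.dist_eq] using hs)).le, h01]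
  · obtain ⟨s₁, hs₁⟩ := Filter.eventually_atTop.1
      ((tendsto_talenti_atTop hn).eventually (gt_mem_nhds hδ))
    refine ⟨max s₁ 1, by positivity, fun s hs => h0 _ (hs₁ s ?_).le⟩
    exact le_trans (le_max_left _ _) hs
  · refine lt_of_le_of_lt ?_ hk
    refine mul_le_mul_of_nonneg_left ?_ hσ.le
    have hmono : ∀ s ∈ Set.Ioi (0 : ℝ), s ^ (n - 1) * deriv (fun s => H k (talenti n s)) s ^ 2 ≤
        s ^ (n - 1) * (deriv (talenti n) s) ^ 2 := by
      intro s hs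
      have hs : 0 < s := hs
      have hd : deriv (fun s => H k (talenti n s)) s =
          deriv (H k) (talenti n s) * deriv (talenti n) s := by
        have hh : DifferentiableAt ℝ (H k) (talenti n s) :=
          (hHs k).differentiable (by simp) _
        have ht : DifferentiableAt ℝ (talenti n) s :=
          (contDiff_talenti n).differentiable (by simp) _
        exact deriv_comp s hh ht
      rw [hd, mul_pow]
      have h2 : deriv (H k) (talenti n s) ^ 2 ≤ 1 := by
        rw [← sq_abs]
        exact pow_le_one₀ (abs_nonneg _) (hHd k _)
      have h3 : deriv (H k) (talenti n s) ^ 2 * deriv (talenti n) s ^ 2 ≤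
          deriv (talenti n) s ^ 2 := mul_le_of_le_one_left (sq_nonneg _) h2
      gcongr
    refine integral_mono_of_nonneg ?_ hFi ?_
    · refine (ae_restrict_iff' measurableSet_Ioi).2 (Filter.Eventually.of_forall fun s hs => ?_)
      have hs : 0 < s := hs
      simp only [Pi.zero_apply]
      positivity
    · exact (ae_restrict_iff' measurableSet_Ioi).2 (Filter.Eventually.of_forall hmono)

theorem exists_nearly_extremal_profile_of_radius {n : ℕ} (hn : 3 ≤ n) {C : ℝ}
    (hC : sobolevConst n < C) {R : ℝ} (hR : 0 < R) :
    ∃ φ : ℝ → ℝ, ContDiff ℝ (⊤ : ℕ∞) φ ∧ (∃ s₀ > 0, ∀ s, |s| < s₀ → φ s = φ 0) ∧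
      (∃ s₁ > 0, s₁ < R ∧ ∀ s ≥ s₁, φ s = 0) ∧
      sphereArea n * ∫ s in Set.Ioi (0 : ℝ), s ^ (n - 1) * (deriv φ s) ^ 2 <
        C * (sphereArea n * ∫ s in Set.Ioi (0 : ℝ),
          s ^ (n - 1) * |φ s| ^ (2 * (n : ℝ) / ((n : ℝ) - 2))) ^ (((n : ℝ) - 2) / n) := by
  have hn' : (3 : ℝ) ≤ n := by exact_mod_cast hn
  obtain ⟨φ, hφ, ⟨s₀, hs₀, hc⟩, ⟨s₁, hs₁, hz⟩, hlt⟩ := exists_nearly_extremal_profile hn hC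
  obtain ⟨b, hb, hbR⟩ : ∃ b : ℝ, 0 < b ∧ s₁ / b < R := by
    refine ⟨2 * s₁ / R, by positivity, ?_⟩
    have : s₁ / (2 * s₁ / R) = R / 2 := by field_simp
    linarith
  have hd : ∀ s, deriv (fun s => φ (b * s)) s = b * deriv φ (b * s) := fun s => by
    simpa using deriv_comp_mul_left b φ s
  refine ⟨fun s => φ (b * s), by fun_prop, ⟨s₀ / b, by positivity, ?_⟩,
    ⟨s₁ / b, by positivity, hbR, ?_⟩, ?_⟩
  · intro s hs
    simp only [mul_zero]
    refine hc _ ?_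
    rw [lt_div_iff₀ hb] at hs
    rw [abs_mul, abs_of_pos hb]
    linarith
  · intro s hs
    refine hz _ ?_
    have := (div_le_iff₀ hb).1 hs
    linarith
  · have hI : ∀ g : ℝ → ℝ, ∫ s in Set.Ioi (0 : ℝ), s ^ (n - 1) * g (b * s) =
        (b ^ n)⁻¹ * ∫ s in Set.Ioi (0 : ℝ), s ^ (n - 1) * g s := by
      intro g
      have h := integral_comp_mul_left_Ioi (fun s => s ^ (n - 1) * g s) 0 hb
      simp only [mul_zero, mul_pow, smul_eq_mul, mul_assoc, integral_const_mul] at h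
      have hbn : b ^ n = b ^ (n - 1) * b := by rw [← pow_succ]; congr 1; lia
      rw [hbn, mul_inv, mul_assoc, ← h, inv_mul_cancel_left₀ (by positivity)]
    have e1 : ∫ s in Set.Ioi (0 : ℝ), s ^ (n - 1) * deriv (fun s => φ (b * s)) s ^ 2 =
        (b ^ (n - 2))⁻¹ * ∫ s in Set.Ioi (0 : ℝ), s ^ (n - 1) * (deriv φ s) ^ 2 := by
      have hbn : b ^ n = b ^ (n - 2) * b ^ 2 := by rw [← pow_add]; congr 1; lia
      simp only [hd]
      rw [hI (fun s => (b * deriv φ s) ^ 2)]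
      simp only [mul_pow, mul_left_comm _ (b ^ 2), integral_const_mul]
      rw [hbn]
      field_simp
    rw [e1, hI (fun s => |φ s| ^ (2 * (n : ℝ) / ((n : ℝ) - 2)))]
    have hσ : 0 ≤ sphereArea n := by unfold sphereArea; positivity
    have hG : 0 ≤ ∫ s in Set.Ioi (0 : ℝ),
        s ^ (n - 1) * |φ s| ^ (2 * (n : ℝ) / ((n : ℝ) - 2)) :=
      setIntegral_nonneg measurableSet_Ioi fun s hs => by
        have hs : 0 < s := hs
        positivity
    have hbp : ((b ^ n)⁻¹) ^ (((n : ℝ) - 2) / n) = (b ^ (n - 2))⁻¹ := by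
      rw [Real.inv_rpow (by positivity), ← Real.rpow_natCast, ← Real.rpow_mul hb.le,
        ← Real.rpow_natCast, Nat.cast_sub (by lia)]
      congr 2
      push_cast
      field_simp
    rw [mul_left_comm _ (b ^ n)⁻¹, Real.mul_rpow (by positivity) (by positivity), hbp,
      mul_left_comm, mul_left_comm C]
    gcongr

section Radial

variable {n : ℕ} {f : ℝ → ℝ} {r₀ r₁ : ℝ}

theorem contDiff_comp_norm_sub (hr₀ : 0 < r₀) (hc : ∀ r, |r| < r₀ → f r = f 0)
    (hf : ∀ r > 0, ContDiffAt ℝ (⊤ : ℕ∞) f r) (y : EuclideanSpace ℝ (Fin n)) :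
    ContDiff ℝ (⊤ : ℕ∞) fun x => f ‖x - y‖ := by
  rw [contDiff_iff_contDiffAt]
  intro x
  rcases eq_or_ne x y with rfl | hxy
  · refine (contDiffAt_const (c := f 0)).congr_of_eventuallyEq ?_
    filter_upwards [Metric.ball_mem_nhds x hr₀] with z hz
    exact hc _ (by simpa [dist_eq_norm] using hz)
  · have h : x - y ≠ 0 := sub_ne_zero.2 hxy
    exact (hf _ (norm_pos_iff.2 h)).comp x
      ((contDiffAt_norm ℝ h).comp x (contDiffAt_id.sub contDiffAt_const))

theorem norm_gradient_comp_norm_sub (hr₀ : 0 < r₀) (hc : ∀ r, |r| < r₀ → f r = f 0)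
    (hf : ∀ r > 0, ContDiffAt ℝ (⊤ : ℕ∞) f r) (x y : EuclideanSpace ℝ (Fin n)) :
    ‖gradient (fun x => f ‖x - y‖) x‖ = |deriv f ‖x - y‖| := by
  rw [gradient, LinearIsometryEquiv.norm_map]
  rcases eq_or_ne x y with rfl | hxy
  · have h1 : (fun z => f ‖z - x‖) =ᶠ[nhds x] fun _ => f 0 := by
      filter_upwards [Metric.ball_mem_nhds x hr₀] with z hz
      exact hc _ (by simpa [dist_eq_norm] using hz)
    have h2 : f =ᶠ[nhds 0] fun _ => f 0 := by
      filter_upwards [Metric.ball_mem_nhds (0 : ℝ) hr₀] with z hz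
      exact hc _ (by simpa using hz)
    rw [h1.fderiv_eq, sub_self, norm_zero, h2.deriv_eq]
    simp
  · have h : x - y ≠ 0 := sub_ne_zero.2 hxy
    have hN : DifferentiableAt ℝ (fun z : EuclideanSpace ℝ (Fin n) => ‖z‖) (x - y) :=
      (contDiffAt_norm ℝ h (n := 1)).differentiableAt (by simp)
    have hD : HasDerivAt f (deriv f ‖x - y‖) ‖x - y‖ :=
      ((hf _ (norm_pos_iff.2 h)).differentiableAt (by simp)).hasDerivAt
    have hF : HasFDerivAt (fun z => ‖z - y‖)
        (fderiv ℝ (fun z : EuclideanSpace ℝ (Fin n) => ‖z‖) (x - y)) x :=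
      hN.hasFDerivAt.comp x ((hasFDerivAt_id x).sub_const y)
    have := hD.comp_hasFDerivAt x hF
    have h3 : fderiv ℝ (fun z => f ‖z - y‖) x = _ := this.fderiv
    have : Nontrivial (EuclideanSpace ℝ (Fin n)) := ⟨x, y, hxy⟩
    rw [h3, norm_smul, norm_fderiv_norm hN, mul_one, Real.norm_eq_abs]

theorem tsupport_comp_norm_sub_subset (hz : ∀ r ≥ r₁, f r = 0) (y : EuclideanSpace ℝ (Fin n)) :
    tsupport (fun x => f ‖x - y‖) ⊆ Metric.closedBall y r₁ := by
  refine closure_minimal (fun x hx => ?_) Metric.isClosed_closedBall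
  rw [Metric.mem_closedBall, dist_eq_norm]
  by_contra! h
  exact hx (hz _ h.le)

theorem deriv_eq_zero_of_forall_ge (hz : ∀ r ≥ r₁, f r = 0) {r : ℝ} (hr : r₁ < r) :
    deriv f r = 0 := by
  have h : f =ᶠ[nhds r] fun _ => 0 := by
    filter_upwards [lt_mem_nhds hr] with z hz'
    exact hz _ hz'.le
  rw [h.deriv_eq, deriv_const]

end Radial

theorem integral_ball_norm_eq_sphereArea_mul {n : ℕ} (hn : 3 ≤ n) (g : ℝ → ℝ) :
    ∫ x in Metric.ball (0 : EuclideanSpace ℝ (Fin n)) 1, g ‖x‖ =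
      sphereArea n * ∫ r in Set.Ioo (0 : ℝ) 1, r ^ (n - 1) * g r := by
  have h := integral_norm_eq_sphereArea_mul hn ((Set.Iio 1).indicator g)
  rw [← integral_indicator measurableSet_ball]
  have e : (Metric.ball (0 : EuclideanSpace ℝ (Fin n)) 1).indicator (fun x => g ‖x‖) =
      fun x => (Set.Iio 1).indicator g ‖x‖ := by
    funext x
    simp [Set.indicator]
  rw [e, h, show Set.Ioo (0 : ℝ) 1 = Set.Ioi 0 ∩ Set.Iio 1 from rfl,
    ← setIntegral_indicator measurableSet_Iio]
  congr 2
  funext r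
  by_cases hr : r < 1 <;> simp [hr]

/-- The inverse of `r ↦ (a - log r) ^ (-1 / (n - 2))`. -/
noncomputable def logRadius (n : ℕ) (a s : ℝ) : ℝ := Real.exp (a - (s ^ (n - 2))⁻¹)

theorem logRadius_pos (n : ℕ) (a s : ℝ) : 0 < logRadius n a s := Real.exp_pos _

theorem strictMonoOn_logRadius {n : ℕ} (hn : 3 ≤ n) (a : ℝ) :
    StrictMonoOn (logRadius n a) (Set.Ioi 0) := by
  intro s hs t _ hst
  have hs : 0 < s := hs
  have h : s ^ (n - 2) < t ^ (n - 2) := pow_lt_pow_left₀ hst hs.le (by lia)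
  have := inv_strictAnti₀ (by positivity) h
  exact Real.exp_lt_exp.2 (by linarith)

theorem hasDerivAt_logRadius {n : ℕ} (hn : 3 ≤ n) (a : ℝ) {s : ℝ} (hs : 0 < s) :
    HasDerivAt (logRadius n a) (((n : ℝ) - 2) * (s ^ (n - 1))⁻¹ * logRadius n a s) s := by
  have h := (((hasDerivAt_pow (n - 2) s).inv (by positivity)).const_sub a).exp
  refine h.congr_deriv ?_
  have e1 : s ^ (n - 1) = s ^ (n - 3) * s ^ 2 := by rw [← pow_add]; congr 1; lia
  have e2 : s ^ (n - 2) = s ^ (n - 3) * s := by rw [← pow_succ]; congr 1; lia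
  change Real.exp (a - (s ^ (n - 2))⁻¹) * _ = _ * Real.exp (a - (s ^ (n - 2))⁻¹)
  rw [show n - 2 - 1 = n - 3 by lia, e1, Nat.cast_sub (by lia), e2]
  push_cast
  field_simp

theorem rpow_log_logRadius {n : ℕ} (hn : 3 ≤ n) (a : ℝ) {s : ℝ} (hs : 0 < s) :
    (a - Real.log (logRadius n a s)) ^ (-(1 / ((n : ℝ) - 2))) = s := by
  have hn' : (3 : ℝ) ≤ n := by exact_mod_cast hn
  have h2 : (n : ℝ) - 2 ≠ 0 := by linarith
  rw [logRadius, Real.log_exp, sub_sub_cancel, Real.inv_rpow (by positivity),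
    ← Real.rpow_neg (by positivity), ← Real.rpow_natCast, ← Real.rpow_mul hs.le,
    Nat.cast_sub (by lia)]
  push_cast
  rw [show ((n : ℝ) - 2) * -(-(1 / ((n : ℝ) - 2))) = 1 by field_simp, Real.rpow_one]

theorem logRadius_rpow_log {n : ℕ} (hn : 3 ≤ n) {a r : ℝ} (hr : 0 < r) (h : 0 < a - Real.log r) :
    logRadius n a ((a - Real.log r) ^ (-(1 / ((n : ℝ) - 2)))) = r := by
  have hn' : (3 : ℝ) ≤ n := by exact_mod_cast hn
  have h2 : (n : ℝ) - 2 ≠ 0 := by linarith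
  rw [logRadius, ← Real.rpow_natCast, ← Real.rpow_mul h.le, Nat.cast_sub (by lia)]
  push_cast
  rw [show -(1 / ((n : ℝ) - 2)) * ((n : ℝ) - 2) = -1 by field_simp, Real.rpow_neg_one, inv_inv,
    sub_sub_cancel, Real.exp_log hr]

theorem logRadius_rpow {n : ℕ} (hn : 3 ≤ n) {a : ℝ} (ha : 0 < a) :
    logRadius n a (a ^ (-(1 / ((n : ℝ) - 2)))) = 1 := by
  simpa using logRadius_rpow_log hn one_pos (show 0 < a - Real.log 1 by simpa)

theorem image_logRadius {n : ℕ} (hn : 3 ≤ n) {a : ℝ} (ha : 0 < a) :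
    logRadius n a '' Set.Ioo 0 (a ^ (-(1 / ((n : ℝ) - 2)))) = Set.Ioo 0 1 := by
  have hR : 0 < a ^ (-(1 / ((n : ℝ) - 2))) := by positivity
  ext r
  constructor
  · rintro ⟨s, ⟨hs, hsR⟩, rfl⟩
    refine ⟨logRadius_pos _ _ _, ?_⟩
    rw [← logRadius_rpow hn ha]
    exact strictMonoOn_logRadius hn a hs hR hsR
  · rintro ⟨h0, h1⟩
    have hl : 0 < a - Real.log r := by linarith [Real.log_neg h0 h1]
    have hs : 0 < (a - Real.log r) ^ (-(1 / ((n : ℝ) - 2))) := by positivity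
    refine ⟨_, ⟨hs, ?_⟩, logRadius_rpow_log hn h0 hl⟩
    rw [← (strictMonoOn_logRadius hn a).lt_iff_lt hs hR, logRadius_rpow_log hn h0 hl,
      logRadius_rpow hn ha]
    exact h1

theorem integral_Ioo_eq_integral_logRadius {n : ℕ} (hn : 3 ≤ n) {a : ℝ} (ha : 0 < a) (g : ℝ → ℝ) :
    ∫ r in Set.Ioo (0 : ℝ) 1, g r =
      ∫ s in Set.Ioo 0 (a ^ (-(1 / ((n : ℝ) - 2)))),
        ((n : ℝ) - 2) * (s ^ (n - 1))⁻¹ * logRadius n a s * g (logRadius n a s) := by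
  have hn' : (3 : ℝ) ≤ n := by exact_mod_cast hn
  rw [← image_logRadius hn ha, integral_image_eq_integral_abs_deriv_smul measurableSet_Ioo
    (fun s hs => (hasDerivAt_logRadius hn a hs.1).hasDerivWithinAt)
    ((strictMonoOn_logRadius hn a).injOn.mono fun s hs => hs.1)]
  refine setIntegral_congr_fun measurableSet_Ioo fun s hs => ?_
  have hs0 : 0 < s := hs.1
  have h1 := logRadius_pos n a s
  have h2 : 0 < (n : ℝ) - 2 := by linarith
  simp only [smul_eq_mul]
  rw [abs_of_pos (by positivity)]

theorem ne_zero_of_lt_mul_rpow_integral {n : ℕ} (hn : 3 ≤ n) {C A : ℝ} (hA : 0 ≤ A)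
    {w : EuclideanSpace ℝ (Fin n) → ℝ} {v : EuclideanSpace ℝ (Fin n) → ℝ}
    {s : Set (EuclideanSpace ℝ (Fin n))}
    (h : A < C * (∫ x in s, w x * |v x| ^ (2 * (n : ℝ) / ((n : ℝ) - 2))) ^ (((n : ℝ) - 2) / n)) :
    v ≠ 0 := by
  have hn' : (3 : ℝ) ≤ n := by exact_mod_cast hn
  have hp : 0 < 2 * (n : ℝ) / ((n : ℝ) - 2) := div_pos (by linarith) (by linarith)
  have hθ : 0 < ((n : ℝ) - 2) / n := div_pos (by linarith) (by linarith)
  rintro rfl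
  simp [Real.zero_rpow hp.ne', Real.zero_rpow hθ.ne'] at h
  linarith

theorem sobolevConst_pos {n : ℕ} (hn : 3 ≤ n) : 0 < sobolevConst n := by
  have hn' : (3 : ℝ) ≤ n := by exact_mod_cast hn
  have hG := Real.Gamma_pos_of_pos (show (0 : ℝ) < n / 2 by linarith)
  have hG' := Real.Gamma_pos_of_pos (show (0 : ℝ) < n by linarith)
  have h2 : 0 < (n : ℝ) - 2 := by linarith
  unfold sobolevConst
  positivity

/-- Test functions concentrating at the origin. -/
theorem exists_test_function_at_origin {n : ℕ} (hn : 3 ≤ n) {a : ℝ} (ha : 0 < a) {C : ℝ}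
    (hC : ((n : ℝ) - 2) ^ (-(2 * ((n : ℝ) - 1)) / (n : ℝ)) * sobolevConst n < C) :
    ∃ v : EuclideanSpace ℝ (Fin n) → ℝ, v ≠ 0 ∧ ContDiff ℝ (⊤ : ℕ∞) v ∧ HasCompactSupport v ∧
      tsupport v ⊆ Metric.ball (0 : EuclideanSpace ℝ (Fin n)) 1 ∧
      (∫ x in Metric.ball (0 : EuclideanSpace ℝ (Fin n)) 1, ‖x‖ ^ (-((n : ℝ) - 2)) * ‖gradient v x‖ ^ 2)
        < C *
          (∫ x in Metric.ball (0 : EuclideanSpace ℝ (Fin n)) 1,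
              ‖x‖ ^ (-(n : ℝ)) * (X1 a ‖x‖) ^ (2 * ((n : ℝ) - 1) / ((n : ℝ) - 2)) *
                |v x| ^ (2 * (n : ℝ) / ((n : ℝ) - 2)))
            ^ (((n : ℝ) - 2) / (n : ℝ)) := by
  have hn' : (3 : ℝ) ≤ n := by exact_mod_cast hn
  have h2 : 0 < (n : ℝ) - 2 := by linarith
  have hp : 0 < 2 * (n : ℝ) / ((n : ℝ) - 2) := div_pos (by linarith) (by linarith)
  set R := a ^ (-(1 / ((n : ℝ) - 2))) with hRdef
  have hR : 0 < R := by positivity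
  have hC' : sobolevConst n < C * ((n : ℝ) - 2) ^ (2 * ((n : ℝ) - 1) / (n : ℝ)) := by
    rw [neg_div, Real.rpow_neg h2.le, inv_mul_lt_iff₀ (by positivity)] at hC
    linarith
  obtain ⟨φ, hφ, ⟨s₀, hs₀, hc⟩, ⟨s₁, hs₁, hs₁R, hz⟩, hlt⟩ :=
    exists_nearly_extremal_profile_of_radius hn hC' hR
  let f : ℝ → ℝ := fun r =>
    if r ≤ 0 then φ 0 else if 1 ≤ r then 0 else φ ((a - Real.log r) ^ (-(1 / ((n : ℝ) - 2))))
  have hfin : ∀ r, 0 < r → r < 1 → f r = φ ((a - Real.log r) ^ (-(1 / ((n : ℝ) - 2)))) := by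
    intro r h0 h1
    simp [f, h0.not_ge, h1.not_ge]
  have hpre : ∀ r, 0 < r → r < 1 → ∃ s, 0 < s ∧ s < R ∧ logRadius n a s = r ∧ f r = φ s := by
    intro r h0 h1
    obtain ⟨s, ⟨hs, hsR⟩, rfl⟩ : r ∈ logRadius n a '' Set.Ioo 0 R := by
      rw [image_logRadius hn ha]; exact ⟨h0, h1⟩
    exact ⟨s, hs, hsR, rfl, by rw [hfin _ h0 h1, rpow_log_logRadius hn a hs]⟩
  have hr₁1 : logRadius n a s₁ < 1 := by
    rw [← logRadius_rpow hn ha]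
    exact strictMonoOn_logRadius hn a hs₁ hR hs₁R
  have hr₀ : 0 < min (logRadius n a s₀) 1 := lt_min (logRadius_pos _ _ _) one_pos
  have hf0 : f 0 = φ 0 := by simp [f]
  have hfc : ∀ r, |r| < min (logRadius n a s₀) 1 → f r = f 0 := by
    intro r hr
    rcases le_or_gt r 0 with h | h
    · simp [f, h]
    · rw [abs_of_pos h] at hr
      obtain ⟨s, hs, -, hsr, hfs⟩ := hpre r h (lt_of_lt_of_le hr (min_le_right _ _))
      rw [hfs, hf0]
      refine hc s ?_
      rw [abs_of_pos hs, ← (strictMonoOn_logRadius hn a).lt_iff_lt hs hs₀, hsr]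
      exact lt_of_lt_of_le hr (min_le_left _ _)
  have hfz : ∀ r ≥ logRadius n a s₁, f r = 0 := by
    intro r hr
    have h0 : 0 < r := lt_of_lt_of_le (logRadius_pos _ _ _) hr
    rcases lt_or_ge r 1 with h | h
    · obtain ⟨s, hs, -, hsr, hfs⟩ := hpre r h0 h
      rw [hfs]
      refine hz s ?_
      rw [ge_iff_le, ← (strictMonoOn_logRadius hn a).le_iff_le hs₁ hs, hsr]
      exact hr
    · simp [f, h, h0.not_ge]
  have hfs : ∀ r > 0, ContDiffAt ℝ (⊤ : ℕ∞) f r := by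
    intro r hr
    rcases lt_or_ge r 1 with h | h
    · have hl : 0 < a - Real.log r := by linarith [Real.log_neg hr h]
      have h3 : ContDiffAt ℝ (⊤ : ℕ∞)
          (fun r => (a - Real.log r) ^ (-(1 / ((n : ℝ) - 2)))) r :=
        (contDiffAt_const.sub (Real.contDiffAt_log.2 hr.ne')).rpow_const_of_ne hl.ne'
      refine (hφ.contDiffAt.comp r h3).congr_of_eventuallyEq ?_
      filter_upwards [Ioo_mem_nhds hr h] with z hz
      exact hfin z hz.1 hz.2
    · refine (contDiffAt_const (c := 0)).congr_of_eventuallyEq ?_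
      filter_upwards [lt_mem_nhds (lt_of_lt_of_le hr₁1 h)] with z hz
      exact hfz z hz.le
  have hfψ : ∀ s, 0 < s → s < R → f (logRadius n a s) = φ s := by
    intro s hs hsR
    rw [hfin _ (logRadius_pos _ _ _), rpow_log_logRadius hn a hs]
    rw [← logRadius_rpow hn ha]
    exact strictMonoOn_logRadius hn a hs hR hsR
  have hdψ : ∀ s, 0 < s → s < R → deriv φ s =
      deriv f (logRadius n a s) * (((n : ℝ) - 2) * (s ^ (n - 1))⁻¹ * logRadius n a s) := by
    intro s hs hsR
    have h3 := ((hfs _ (logRadius_pos n a s)).differentiableAt (by simp)).hasDerivAt.comp s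
      (hasDerivAt_logRadius hn a hs)
    rw [← h3.deriv]
    refine Filter.EventuallyEq.deriv_eq ?_
    filter_upwards [Ioo_mem_nhds hs hsR] with z hz
    exact (hfψ z hz.1 hz.2).symm
  have htsupp : tsupport (fun x : EuclideanSpace ℝ (Fin n) => f ‖x - 0‖) ⊆
      Metric.closedBall 0 (logRadius n a s₁) := tsupport_comp_norm_sub_subset hfz 0
  have hL : ∫ x in Metric.ball (0 : EuclideanSpace ℝ (Fin n)) 1,
      ‖x‖ ^ (-((n : ℝ) - 2)) * ‖gradient (fun x => f ‖x - 0‖) x‖ ^ 2 =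
      ((n : ℝ) - 2)⁻¹ *
        (sphereArea n * ∫ s in Set.Ioi (0 : ℝ), s ^ (n - 1) * (deriv φ s) ^ 2) := by
    simp only [fun x => norm_gradient_comp_norm_sub hr₀ hfc hfs x (0 : EuclideanSpace ℝ (Fin n)),
      sq_abs]
    simp only [sub_zero]
    rw [integral_ball_norm_eq_sphereArea_mul hn
        (fun r => r ^ (-((n : ℝ) - 2)) * deriv f r ^ 2),
      integral_Ioo_eq_integral_logRadius hn ha, mul_left_comm _ (sphereArea n),
      setIntegral_eq_of_subset_of_forall_sdiff_eq_zero measurableSet_Ioi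
        (Set.Ioo_subset_Ioi_self : Set.Ioo 0 R ⊆ Set.Ioi 0)
        (f := fun s => s ^ (n - 1) * (deriv φ s) ^ 2)]
    · congr 1
      rw [← integral_const_mul]
      refine setIntegral_congr_fun measurableSet_Ioo fun s hs => ?_
      have hs0 : 0 < s := hs.1
      have hψ := logRadius_pos n a s
      have e : logRadius n a s ^ (-((n : ℝ) - 2)) * logRadius n a s ^ (n - 1) =
          logRadius n a s := by
        rw [← Real.rpow_natCast, ← Real.rpow_add hψ, Nat.cast_sub (by lia)]
        push_cast
        rw [show -((n : ℝ) - 2) + (n - 1) = 1 by ring, Real.rpow_one]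
      rw [hdψ s hs.1 hs.2]
      calc _ = ((n : ℝ) - 2) * (s ^ (n - 1))⁻¹ * logRadius n a s *
            ((logRadius n a s ^ (-((n : ℝ) - 2)) * logRadius n a s ^ (n - 1)) *
              deriv f (logRadius n a s) ^ 2) := by ring
        _ = _ := by
          rw [e]
          field_simp
    · intro s hs
      have : R ≤ s := not_lt.1 fun h => hs.2 ⟨hs.1, h⟩
      rw [deriv_eq_zero_of_forall_ge hz (by linarith)]
      simp
  have hG : ∫ x in Metric.ball (0 : EuclideanSpace ℝ (Fin n)) 1,
      ‖x‖ ^ (-(n : ℝ)) * (X1 a ‖x‖) ^ (2 * ((n : ℝ) - 1) / ((n : ℝ) - 2)) *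
        |f ‖x - 0‖| ^ (2 * (n : ℝ) / ((n : ℝ) - 2)) =
      ((n : ℝ) - 2) * (sphereArea n * ∫ s in Set.Ioi (0 : ℝ),
          s ^ (n - 1) * |φ s| ^ (2 * (n : ℝ) / ((n : ℝ) - 2))) := by
    simp only [sub_zero]
    rw [integral_ball_norm_eq_sphereArea_mul hn
        (fun r => r ^ (-(n : ℝ)) * (X1 a r) ^ (2 * ((n : ℝ) - 1) / ((n : ℝ) - 2)) *
        |f r| ^ (2 * (n : ℝ) / ((n : ℝ) - 2))),
      integral_Ioo_eq_integral_logRadius hn ha, mul_left_comm _ (sphereArea n),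
      setIntegral_eq_of_subset_of_forall_sdiff_eq_zero measurableSet_Ioi
        (Set.Ioo_subset_Ioi_self : Set.Ioo 0 R ⊆ Set.Ioi 0)
        (f := fun s => s ^ (n - 1) * |φ s| ^ (2 * (n : ℝ) / ((n : ℝ) - 2)))]
    · congr 1
      rw [← integral_const_mul]
      refine setIntegral_congr_fun measurableSet_Ioo fun s hs => ?_
      have hs0 : 0 < s := hs.1
      have hψ := logRadius_pos n a s
      have e : logRadius n a s ^ (-(n : ℝ)) * logRadius n a s ^ (n - 1) * logRadius n a s = 1 := by
        rw [mul_assoc, ← pow_succ, ← Real.rpow_natCast, ← Real.rpow_add hψ,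
          show n - 1 + 1 = n by lia, neg_add_cancel, Real.rpow_zero]
      have eX : X1 a (logRadius n a s) ^ (2 * ((n : ℝ) - 1) / ((n : ℝ) - 2)) =
          s ^ (n - 1) * s ^ (n - 1) := by
        rw [X1, logRadius, Real.log_exp, sub_sub_cancel, inv_inv, ← Real.rpow_natCast,
          ← Real.rpow_mul hs0.le, ← pow_add, ← Real.rpow_natCast, Nat.cast_sub (by lia)]
        congr 1
        push_cast [Nat.cast_sub (show 1 ≤ n by lia)]
        field_simp
        ring
      rw [hfψ s hs.1 hs.2, eX]
      calc _ = ((n : ℝ) - 2) * ((s ^ (n - 1))⁻¹ * s ^ (n - 1)) * s ^ (n - 1) *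
            (logRadius n a s ^ (-(n : ℝ)) * logRadius n a s ^ (n - 1) * logRadius n a s) *
              |φ s| ^ (2 * (n : ℝ) / ((n : ℝ) - 2)) := by ring
        _ = _ := by
          rw [e, inv_mul_cancel₀ (by positivity)]
          ring
    · intro s hs
      have : R ≤ s := not_lt.1 fun h => hs.2 ⟨hs.1, h⟩
      rw [hz s (by linarith)]
      simp [Real.zero_rpow hp.ne']
  have hσ : 0 ≤ sphereArea n := by unfold sphereArea; positivity
  have hBnn : 0 ≤ ∫ s in Set.Ioi (0 : ℝ),
      s ^ (n - 1) * |φ s| ^ (2 * (n : ℝ) / ((n : ℝ) - 2)) :=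
    setIntegral_nonneg measurableSet_Ioi fun s hs => by
      have hs : 0 < s := hs
      positivity
  have hAnn : 0 ≤ ∫ s in Set.Ioi (0 : ℝ), s ^ (n - 1) * (deriv φ s) ^ 2 :=
    setIntegral_nonneg measurableSet_Ioi fun s hs => by
      have hs : 0 < s := hs
      positivity
  have main : (∫ x in Metric.ball (0 : EuclideanSpace ℝ (Fin n)) 1,
      ‖x‖ ^ (-((n : ℝ) - 2)) * ‖gradient (fun x => f ‖x - 0‖) x‖ ^ 2) < C *
      (∫ x in Metric.ball (0 : EuclideanSpace ℝ (Fin n)) 1,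
        ‖x‖ ^ (-(n : ℝ)) * (X1 a ‖x‖) ^ (2 * ((n : ℝ) - 1) / ((n : ℝ) - 2)) *
        |f ‖x - 0‖| ^ (2 * (n : ℝ) / ((n : ℝ) - 2))) ^ (((n : ℝ) - 2) / (n : ℝ)) := by
    rw [hL, hG, Real.mul_rpow h2.le (by positivity), inv_mul_lt_iff₀ h2]
    refine lt_of_lt_of_eq hlt ?_
    have e : ((n : ℝ) - 2) ^ (2 * ((n : ℝ) - 1) / (n : ℝ)) =
        ((n : ℝ) - 2) * ((n : ℝ) - 2) ^ (((n : ℝ) - 2) / (n : ℝ)) := by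
      rw [mul_comm ((n : ℝ) - 2), ← Real.rpow_add_one h2.ne']
      congr 1
      field_simp
      ring
    rw [e]
    ring
  refine ⟨fun x => f ‖x - 0‖, ne_zero_of_lt_mul_rpow_integral hn ?_ main,
    contDiff_comp_norm_sub hr₀ hfc hfs 0,
    (isCompact_closedBall _ _).of_isClosed_subset (isClosed_tsupport _) htsupp,
    htsupp.trans (Metric.closedBall_subset_ball hr₁1), main⟩
  rw [hL]
  positivity

/-- Test functions concentrating at a boundary point. -/
theorem exists_test_function_near_boundary {n : ℕ} (hn : 3 ≤ n) {a : ℝ} (ha : 0 < a) {C : ℝ}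
    (hC : a ^ (2 * ((n : ℝ) - 1) / (n : ℝ)) * sobolevConst n < C) :
    ∃ v : EuclideanSpace ℝ (Fin n) → ℝ, v ≠ 0 ∧ ContDiff ℝ (⊤ : ℕ∞) v ∧ HasCompactSupport v ∧
      tsupport v ⊆ Metric.ball (0 : EuclideanSpace ℝ (Fin n)) 1 ∧
      (∫ x in Metric.ball (0 : EuclideanSpace ℝ (Fin n)) 1, ‖x‖ ^ (-((n : ℝ) - 2)) * ‖gradient v x‖ ^ 2)
        < C *
          (∫ x in Metric.ball (0 : EuclideanSpace ℝ (Fin n)) 1,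
              ‖x‖ ^ (-(n : ℝ)) * (X1 a ‖x‖) ^ (2 * ((n : ℝ) - 1) / ((n : ℝ) - 2)) *
                |v x| ^ (2 * (n : ℝ) / ((n : ℝ) - 2)))
            ^ (((n : ℝ) - 2) / (n : ℝ)) := by
  have hn' : (3 : ℝ) ≤ n := by exact_mod_cast hn
  have h2 : 0 < (n : ℝ) - 2 := by linarith
  have hp : 0 < 2 * (n : ℝ) / ((n : ℝ) - 2) := div_pos (by linarith) (by linarith)
  have hq : 0 < 2 * ((n : ℝ) - 1) / ((n : ℝ) - 2) := div_pos (by linarith) (by linarith)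
  have hCpos : 0 < C := lt_trans (mul_pos (by positivity) (sobolevConst_pos hn)) hC
  obtain ⟨ρ, hρ0, hρ1, hρC⟩ : ∃ ρ : ℝ, 0 < ρ ∧ ρ < 1 ∧ sobolevConst n <
      C * ρ ^ ((n : ℝ) - 2) * (a - Real.log ρ) ^ (-(2 * ((n : ℝ) - 1) / (n : ℝ))) := by
    have hcont : ContinuousAt (fun ρ : ℝ => C * ρ ^ ((n : ℝ) - 2) *
        (a - Real.log ρ) ^ (-(2 * ((n : ℝ) - 1) / (n : ℝ)))) 1 := by
      refine ContinuousAt.mul (continuousAt_const.mul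
        (continuousAt_id.rpow_const (Or.inl one_ne_zero))) ?_
      refine ContinuousAt.rpow_const
        (continuousAt_const.sub (Real.continuousAt_log one_ne_zero)) (Or.inl ?_)
      simpa using ha.ne'
    have hev := hcont.eventually (lt_mem_nhds (a := sobolevConst n) (by
      simp only [Real.one_rpow, Real.log_one, sub_zero, mul_one]
      rw [Real.rpow_neg ha.le, ← div_eq_mul_inv, lt_div_iff₀ (by positivity)]
      linarith))
    obtain ⟨l, hl, hI⟩ := exists_Ioc_subset_of_mem_nhds hev ⟨0, zero_lt_one⟩
    refine ⟨(max l 0 + 1) / 2, by positivity, ?_, ?_⟩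
    · linarith [max_lt hl zero_lt_one]
    · refine hI ⟨?_, ?_⟩
      · linarith [max_lt hl zero_lt_one, le_max_left l 0]
      · linarith [max_lt hl zero_lt_one]
  have hL : 0 < a - Real.log ρ := by linarith [Real.log_neg hρ0 hρ1]
  obtain ⟨φ, hφ, ⟨s₀, hs₀, hc⟩, ⟨s₁, hs₁, hs₁R, hz⟩, hlt⟩ :=
    exists_nearly_extremal_profile_of_radius hn hρC (R := (1 - ρ) / 2) (by linarith)
  have hφs : ∀ r > 0, ContDiffAt ℝ (⊤ : ℕ∞) φ r := fun r _ => hφ.contDiffAt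
  let y : EuclideanSpace ℝ (Fin n) := EuclideanSpace.single ⟨0, by lia⟩ ((1 + ρ) / 2)
  have hy : ‖y‖ = (1 + ρ) / 2 := by
    simp only [y, PiLp.norm_single, Real.norm_eq_abs]
    rw [abs_of_pos (by linarith)]
  let v : EuclideanSpace ℝ (Fin n) → ℝ := fun x => φ ‖x - y‖
  have hgrad : ∀ x, ‖gradient v x‖ ^ 2 = (deriv φ ‖x - y‖) ^ 2 := fun x => by
    rw [norm_gradient_comp_norm_sub hs₀ hc hφs x y, sq_abs]
  have hnear : ∀ x, ‖x - y‖ < (1 - ρ) / 2 → ρ < ‖x‖ ∧ ‖x‖ < 1 := by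
    intro x hx
    have h3 := norm_sub_norm_le y x
    have h4 := norm_sub_norm_le x y
    rw [norm_sub_rev y x] at h3
    constructor <;> linarith
  have hvz : ∀ x, ¬ ‖x - y‖ < (1 - ρ) / 2 → v x = 0 := fun x hx => hz _ (by linarith)
  have hdz : ∀ x, ¬ ‖x - y‖ < (1 - ρ) / 2 → deriv φ ‖x - y‖ = 0 := fun x hx =>
    deriv_eq_zero_of_forall_ge hz (by linarith)
  have htsupp : tsupport v ⊆ Metric.closedBall y s₁ := tsupport_comp_norm_sub_subset hz y
  have hIntegrable : ∀ g : EuclideanSpace ℝ (Fin n) → ℝ, Continuous g →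
      (∀ x, ¬ ‖x - y‖ < (1 - ρ) / 2 → g x = 0) → Integrable g := by
    intro g hg hg0
    refine hg.integrable_of_hasCompactSupport
      (HasCompactSupport.intro (isCompact_closedBall y ((1 - ρ) / 2)) fun x hx => hg0 x ?_)
    rw [Metric.mem_closedBall, dist_eq_norm] at hx
    exact fun h => hx h.le
  have hdcont : Continuous (deriv φ) := hφ.continuous_deriv (by simp)
  have hvcont : Continuous v := by
    have := hφ.continuous
    fun_prop
  have hdi : Integrable fun x => (deriv φ ‖x - y‖) ^ 2 :=
    hIntegrable _ (by fun_prop) fun x hx => by rw [hdz x hx]; simp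
  have hvi : Integrable fun x => |v x| ^ (2 * (n : ℝ) / ((n : ℝ) - 2)) :=
    hIntegrable _ (hvcont.abs.rpow_const fun _ => Or.inr hp.le) fun x hx => by
      rw [hvz x hx]; simp [Real.zero_rpow hp.ne']
  have htrans : ∀ g : ℝ → ℝ, ∫ x : EuclideanSpace ℝ (Fin n), g ‖x - y‖ =
      sphereArea n * ∫ r in Set.Ioi (0 : ℝ), r ^ (n - 1) * g r := fun g => by
    rw [integral_sub_right_eq_self (fun x => g ‖x‖) y, integral_norm_eq_sphereArea_mul hn]
  have hLHS : ∫ x in Metric.ball (0 : EuclideanSpace ℝ (Fin n)) 1,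
      ‖x‖ ^ (-((n : ℝ) - 2)) * ‖gradient v x‖ ^ 2 ≤ ρ ^ (-((n : ℝ) - 2)) *
        (sphereArea n * ∫ s in Set.Ioi (0 : ℝ), s ^ (n - 1) * (deriv φ s) ^ 2) := by
    simp only [hgrad]
    rw [← htrans (fun s => deriv φ s ^ 2), ← integral_const_mul]
    refine le_trans (integral_mono_of_nonneg (Filter.Eventually.of_forall fun x => ?_)
      (hdi.const_mul _).integrableOn (Filter.Eventually.of_forall fun x => ?_))
      (setIntegral_le_integral (hdi.const_mul _) (Filter.Eventually.of_forall fun x => ?_))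
    · simp only [Pi.zero_apply]; positivity
    · by_cases hx : ‖x - y‖ < (1 - ρ) / 2
      · have := Real.rpow_le_rpow_of_nonpos hρ0 (hnear x hx).1.le
          (show -((n : ℝ) - 2) ≤ 0 by linarith)
        simp only
        gcongr
      · simp [hdz x hx]
    · simp only [Pi.zero_apply]; positivity
  have hRHS : (a - Real.log ρ) ^ (-(2 * ((n : ℝ) - 1) / ((n : ℝ) - 2))) *
      (sphereArea n * ∫ s in Set.Ioi (0 : ℝ),
          s ^ (n - 1) * |φ s| ^ (2 * (n : ℝ) / ((n : ℝ) - 2))) ≤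
      ∫ x in Metric.ball (0 : EuclideanSpace ℝ (Fin n)) 1,
        ‖x‖ ^ (-(n : ℝ)) * (X1 a ‖x‖) ^ (2 * ((n : ℝ) - 1) / ((n : ℝ) - 2)) *
        |v x| ^ (2 * (n : ℝ) / ((n : ℝ) - 2)) := by
    rw [← htrans (fun s => |φ s| ^ (2 * (n : ℝ) / ((n : ℝ) - 2))), ← integral_const_mul,
      ← setIntegral_eq_integral_of_forall_compl_eq_zero
        (s := Metric.ball (0 : EuclideanSpace ℝ (Fin n)) 1)]
    · refine setIntegral_mono (hvi.const_mul _).integrableOn ?_ fun x => ?_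
      · refine Integrable.mono' (g := fun x => ρ ^ (-(n : ℝ)) *
          (a⁻¹) ^ (2 * ((n : ℝ) - 1) / ((n : ℝ) - 2)) *
            |v x| ^ (2 * (n : ℝ) / ((n : ℝ) - 2))) (hvi.const_mul _).integrableOn ?_
          (Filter.Eventually.of_forall fun x => ?_)
        · have := hvcont.measurable
          unfold X1
          exact Measurable.aestronglyMeasurable (by fun_prop)
        · by_cases hx : ‖x - y‖ < (1 - ρ) / 2
          · obtain ⟨h3, h4⟩ := hnear x hx
            have h5 : 0 < ‖x‖ := hρ0.trans h3
            have h6 : a ≤ a - Real.log ‖x‖ := by linarith [Real.log_neg h5 h4]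
            have h7 : 0 < a - Real.log ‖x‖ := by linarith
            have h8 : X1 a ‖x‖ ≤ a⁻¹ := inv_anti₀ ha h6
            have h9 : 0 < X1 a ‖x‖ := inv_pos.2 h7
            have := Real.rpow_le_rpow_of_nonpos hρ0 h3.le (show -(n : ℝ) ≤ 0 by linarith)
            rw [Real.norm_of_nonneg (by positivity)]
            gcongr
          · simp [hvz x hx, Real.zero_rpow hp.ne']
      · by_cases hx : ‖x - y‖ < (1 - ρ) / 2
        · obtain ⟨h3, h4⟩ := hnear x hx
          have h5 : 0 < ‖x‖ := hρ0.trans h3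
          have h6 : a - Real.log ‖x‖ ≤ a - Real.log ρ := by
            linarith [Real.log_le_log hρ0 h3.le]
          have h7 : 0 < a - Real.log ‖x‖ := by linarith [Real.log_neg h5 h4]
          have h8 : (a - Real.log ρ)⁻¹ ≤ X1 a ‖x‖ := inv_anti₀ h7 h6
          have h9 := Real.one_le_rpow_of_pos_of_le_one_of_nonpos h5 h4.le
            (show -(n : ℝ) ≤ 0 by linarith)
          have h10 := Real.rpow_le_rpow (by positivity) h8 hq.le
          rw [Real.inv_rpow hL.le, ← Real.rpow_neg hL.le] at h10
          have h11 : 0 ≤ (a - Real.log ρ) ^ (-(2 * ((n : ℝ) - 1) / ((n : ℝ) - 2))) := by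
            positivity
          have h12 := mul_le_mul h9 h10 h11 (by positivity)
          rw [one_mul] at h12
          exact mul_le_mul_of_nonneg_right h12 (by positivity)
        · have h3 := hvz x hx
          simp only [h3]
          change _ * |v x| ^ _ ≤ _
          simp [h3, Real.zero_rpow hp.ne']
    · intro x hx
      have h3 : v x = 0 := hvz x fun h => hx (by simpa using (hnear x h).2)
      change _ * |v x| ^ _ = 0
      simp [h3, Real.zero_rpow hp.ne']
  have hσ : 0 ≤ sphereArea n := by unfold sphereArea; positivity
  have hBnn : 0 ≤ ∫ s in Set.Ioi (0 : ℝ),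
      s ^ (n - 1) * |φ s| ^ (2 * (n : ℝ) / ((n : ℝ) - 2)) :=
    setIntegral_nonneg measurableSet_Ioi fun s hs => by
      have hs : 0 < s := hs
      positivity
  have main : (∫ x in Metric.ball (0 : EuclideanSpace ℝ (Fin n)) 1,
      ‖x‖ ^ (-((n : ℝ) - 2)) * ‖gradient v x‖ ^ 2) < C *
      (∫ x in Metric.ball (0 : EuclideanSpace ℝ (Fin n)) 1,
        ‖x‖ ^ (-(n : ℝ)) * (X1 a ‖x‖) ^ (2 * ((n : ℝ) - 1) / ((n : ℝ) - 2)) *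
        |v x| ^ (2 * (n : ℝ) / ((n : ℝ) - 2))) ^ (((n : ℝ) - 2) / (n : ℝ)) := by
    refine lt_of_le_of_lt hLHS (lt_of_lt_of_le (mul_lt_mul_of_pos_left hlt (by positivity)) ?_)
    have h3 := mul_le_mul_of_nonneg_left (Real.rpow_le_rpow (by positivity) hRHS
      (show 0 ≤ ((n : ℝ) - 2) / (n : ℝ) by positivity)) hCpos.le
    refine le_trans (le_of_eq ?_) h3
    rw [Real.mul_rpow (x := (a - Real.log ρ) ^ (-(2 * ((n : ℝ) - 1) / ((n : ℝ) - 2))))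
      (by positivity) (by positivity), ← Real.rpow_mul hL.le,
      Real.rpow_neg hρ0.le, show -(2 * ((n : ℝ) - 1) / ((n : ℝ) - 2)) * (((n : ℝ) - 2) / n) =
        -(2 * ((n : ℝ) - 1) / n) by field_simp]
    have h4 : ρ ^ ((n : ℝ) - 2) ≠ 0 := by positivity
    field_simp
  refine ⟨v, ne_zero_of_lt_mul_rpow_integral hn ?_ main,
    contDiff_comp_norm_sub hs₀ hc hφs y,
    (isCompact_closedBall _ _).of_isClosed_subset (isClosed_tsupport _) htsupp,
    htsupp.trans fun x hx => ?_, main⟩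
  · exact setIntegral_nonneg measurableSet_ball fun x _ => by positivity
  · rw [Metric.mem_closedBall, dist_eq_norm] at hx
    simpa using (hnear x (by linarith)).2

theorem stmt9 (n : ℕ) (hn : 3 ≤ n) (a : ℝ) (ha0 : 0 < a)
    (Cna : ℝ)
    (hCna : Cna = if 1 / ((n : ℝ) - 2) ≤ a then ((n : ℝ) - 2) ^ (-(2 * ((n : ℝ) - 1)) / (n : ℝ)) * sobolevConst n else a ^ (2 * ((n : ℝ) - 1) / (n : ℝ)) * sobolevConst n)
    (C : ℝ) (hC : C > Cna) :
    ∃ v : EuclideanSpace ℝ (Fin n) → ℝ, v ≠ 0 ∧ ContDiff ℝ (⊤ : ℕ∞) v ∧ HasCompactSupport v ∧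
      tsupport v ⊆ Metric.ball (0 : EuclideanSpace ℝ (Fin n)) 1 ∧
      (∫ x in Metric.ball (0 : EuclideanSpace ℝ (Fin n)) 1, ‖x‖ ^ (-((n : ℝ) - 2)) * ‖gradient v x‖ ^ 2)
        < C *
          (∫ x in Metric.ball (0 : EuclideanSpace ℝ (Fin n)) 1,
              ‖x‖ ^ (-(n : ℝ)) * (X1 a ‖x‖) ^ (2 * ((n : ℝ) - 1) / ((n : ℝ) - 2)) *
                |v x| ^ (2 * (n : ℝ) / ((n : ℝ) - 2)))
            ^ (((n : ℝ) - 2) / (n : ℝ)) := by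
  subst hCna
  split_ifs at hC with h
  · exact exists_test_function_at_origin hn ha0 hC
  · exact exists_test_function_near_boundary hn ha0 hC
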